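/- If a regular cardinal κ > 2^{ℵ₁} carries a uniform indecomposable ultrafilter, then every κ-Aronszajn tree admits an ω-ascent path. -/

import Mathlib

open Set Cardinal

/-- An ultrafilter `U` over `I` is `μ`-decomposable if there is `f : I → μ` such that
`f ⁻¹' H ∉ U` for every `H ⊆ μ` of cardinality `< μ`. -/
def MuDecomposable {I : Type} (U : Ultrafilter I) (μ : Cardinal.{0}) : Prop :=
  ∃ f : I → μ.out, ∀ H : Set μ.out, #H < μ → f ⁻¹' H ∉ U

/-- `U` is uniform: every member has full cardinality. -/
def UniformUF {I : Type} (U : Ultrafilter I) : Prop := ∀ X ∈ U, #X = #I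

/-- A tree, presented by its strict order and a level function. -/
structure OrdTree where
  carrier : Type
  lt : carrier → carrier → Prop
  level : carrier → Ordinal.{0}

/-- `T` is a tree of height `lam`. -/
def OrdTree.IsOfHeight (T : OrdTree) (lam : Ordinal.{0}) : Prop :=
  (∀ x y z, T.lt x y → T.lt y z → T.lt x z) ∧
  (∀ x, ¬ T.lt x x) ∧
  (∀ x y, T.lt x y → T.level x < T.level y) ∧
  (∀ y, ∀ α < T.level y, ∃! x, T.lt x y ∧ T.level x = α) ∧
  (∀ x y z, T.lt x z → T.lt y z → (x = y ∨ T.lt x y ∨ T.lt y x)) ∧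
  (∀ x, T.level x < lam) ∧ (∀ α < lam, ∃ x, T.level x = α)

/-- All levels of `T` below `lam` have size `< κ`. -/
def OrdTree.SmallLevels (T : OrdTree) (lam : Ordinal.{0}) (κ : Cardinal.{0}) : Prop :=
  ∀ α < lam, #{x : T.carrier // T.level x = α} < κ

/-- `B` is a cofinal branch of `T`. -/
def OrdTree.CofinalBranch (T : OrdTree) (lam : Ordinal.{0}) (B : Set T.carrier) : Prop :=
  (∀ x ∈ B, ∀ y ∈ B, x = y ∨ T.lt x y ∨ T.lt y x) ∧
  ∀ α < lam, ∃ x ∈ B, α ≤ T.level x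

/-- `T` is a `κ`-Aronszajn tree. -/
def OrdTree.Aronszajn (T : OrdTree) (κ : Cardinal.{0}) : Prop :=
  T.IsOfHeight κ.ord ∧ T.SmallLevels κ.ord κ ∧ ¬ ∃ B, T.CofinalBranch κ.ord B

open Filter in
/-- An indecomposable ultrafilter concentrates on countably many fibres of a small map. -/
theorem countable_conc {K : Type} {κ : Cardinal.{0}} (U : Ultrafilter K)
    (hind : ∀ μ : Cardinal.{0}, Cardinal.aleph 1 ≤ μ → μ < κ → ¬ MuDecomposable U μ)
    {A : Type} (hA : #A < κ) (f : K → A) :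
    ∃ H : Set A, H.Countable ∧ f ⁻¹' H ∈ U := by
  classical
  let S : Set Cardinal.{0} := {c | ∃ H : Set A, #H = c ∧ f ⁻¹' H ∈ U}
  have hS : S.Nonempty := ⟨_, Set.univ, rfl, Filter.univ_mem⟩
  obtain ⟨H, hHc, hH⟩ := WellFounded.min_mem Cardinal.lt_wf S hS
  have hmin : ∀ H' : Set A, f ⁻¹' H' ∈ U → ¬ #H' < #H := by
    intro H' h' hlt
    rw [hHc] at hlt
    exact WellFounded.not_lt_min Cardinal.lt_wf S ⟨H', rfl, h'⟩ hlt
  refine ⟨H, ?_, hH⟩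
  by_contra hc
  have h1 : Cardinal.aleph 1 ≤ #H := by
    rw [← Cardinal.succ_aleph0, Order.succ_le_iff, ← not_le,
      Cardinal.le_aleph0_iff_set_countable]
    exact hc
  have hlt : #H < κ := (Cardinal.mk_set_le H).trans_lt hA
  have hnd := hind _ h1 hlt
  obtain ⟨e⟩ : Nonempty (H ≃ (#H).out) := Cardinal.eq.1 (by simp)
  obtain ⟨x0, hx0⟩ := U.nonempty_of_mem hH
  unfold MuDecomposable at hnd
  push Not at hnd
  obtain ⟨H', hH', hm⟩ := hnd (fun x => if h : f x ∈ H then e ⟨f x, h⟩ else e ⟨f x0, hx0⟩)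
  refine hmin ((fun y => (e.symm y : A)) '' H') ?_ (Cardinal.mk_image_le.trans_lt hH')
  filter_upwards [hH, hm] with x hx hx'
  have hx2 : f x ∈ H := hx
  simp only [Set.mem_preimage, dif_pos hx2] at hx'
  exact ⟨_, hx', by simp⟩

open Filter in
theorem countable_code {K : Type} {κ : Cardinal.{0}} (U : Ultrafilter K)
    (hind : ∀ μ : Cardinal.{0}, Cardinal.aleph 1 ≤ μ → μ < κ → ¬ MuDecomposable U μ)
    {A : Type} (hA : #A < κ) (f : K → A) :
    ∃ (c : K → ℕ) (p : ℕ → A), ∀ᶠ x in (U : Filter K), f x = p (c x) := by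
  classical
  obtain ⟨H, hc, hH⟩ := countable_conc U hind hA f
  obtain ⟨x0, hx0⟩ := U.nonempty_of_mem hH
  obtain ⟨p, hp⟩ := hc.exists_eq_range ⟨_, hx0⟩
  refine ⟨fun x => if h : ∃ n, p n = f x then h.choose else 0, p, ?_⟩
  filter_upwards [hH] with x hx
  have h : ∃ n, p n = f x := by
    have : f x ∈ H := hx
    rw [hp] at this
    exact this
  simp only [dif_pos h]
  exact h.choose_spec.symm

open Filter in
/-- Silver-type argument: countably many of the functions `c a` determine all of them mod `U`. -/
theorem silver_lemma {K : Type} {κ : Cardinal.{0}} (U : Ultrafilter K)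
    (hκ : 2 ^ Cardinal.aleph 1 < κ)
    (hind : ∀ μ : Cardinal.{0}, Cardinal.aleph 1 ≤ μ → μ < κ → ¬ MuDecomposable U μ)
    (c : K → K → ℕ) :
    ∃ S : Set K, S.Countable ∧ ∀ a, ∃ X ∈ U, ∀ x ∈ X, ∀ y ∈ X,
      (∀ s ∈ S, c s x = c s y) → c a x = c a y := by
  classical
  by_contra hcon
  push Not at hcon
  have hK : Nonempty K := by
    obtain ⟨x, -⟩ := U.nonempty_of_mem (Filter.univ_mem : Set.univ ∈ (U : Filter K))
    exact ⟨x⟩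
  have hcon' : ∀ S : Set K, ∃ a, S.Countable → ∀ X ∈ U, ∃ x ∈ X, ∃ y ∈ X,
      (∀ s ∈ S, c s x = c s y) ∧ c a x ≠ c a y := by
    intro S
    by_cases hS : S.Countable
    · obtain ⟨a, ha⟩ := hcon S hS
      exact ⟨a, fun _ => ha⟩
    · exact ⟨hK.some, fun h => (hS h).elim⟩
  choose F hF using hcon'
  let W : Type := (Cardinal.aleph 1).ord.ToType
  have hWc : #W = Cardinal.aleph 1 := by simp [W]
  have hIio : ∀ w : W, (Set.Iio w).Countable := by
    intro w
    have := Cardinal.mk_Iio_toType_ord_lt w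
    rw [← Cardinal.le_aleph0_iff_set_countable]
    exact Order.lt_succ_iff.1 (this.trans_eq Cardinal.succ_aleph0.symm)
  let wfW : WellFounded (fun a b : W => a < b) := wellFounded_lt
  let s : W → K := wfW.fix (fun w ih => F {k | ∃ v, ∃ h : v < w, ih v h = k})
  have hs : ∀ w, s w = F (s '' Set.Iio w) := by
    intro w
    have h1 : s w = F {k | ∃ v, ∃ _ : v < w, s v = k} := wfW.fix_eq _ w
    rw [h1]
    congr 1
    ext k
    simp
  have hcard : #(W → ℕ) < κ := by
    rw [← Cardinal.power_def, hWc, Cardinal.mk_nat]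
    refine lt_of_le_of_lt ?_ hκ
    rw [← Cardinal.power_self_eq (Cardinal.aleph0_le_aleph 1)]
    exact Cardinal.power_le_power_right (Cardinal.aleph0_le_aleph 1)
  obtain ⟨H, hHc, hH⟩ := countable_conc U hind hcard (fun x w => c (s w) x)
  have hd : ∀ p : (W → ℕ) × (W → ℕ), ∃ w, p.1 ≠ p.2 → p.1 w ≠ p.2 w := by
    intro p
    by_cases h : p.1 = p.2
    · exact ⟨Classical.choice (by
        rw [← Cardinal.mk_ne_zero_iff, hWc]
        exact (Cardinal.aleph_pos 1).ne'), fun h' => (h' h).elim⟩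
    · obtain ⟨w, hw⟩ := Function.ne_iff.1 h
      exact ⟨w, fun _ => hw⟩
  choose d hd using hd
  obtain ⟨w, hw⟩ : ∃ w : W, ∀ p ∈ H, ∀ q ∈ H, d (p, q) < w := by
    have hcnt : (⋃ z ∈ d '' (H ×ˢ H), Set.Iic z).Countable := by
      refine Set.Countable.biUnion ((hHc.prod hHc).image _) (fun z _ => ?_)
      rw [← Set.Iio_insert]
      exact (hIio z).insert z
    have hne : (⋃ z ∈ d '' (H ×ˢ H), Set.Iic z) ≠ Set.univ := by
      intro h
      rw [h, Set.countable_univ_iff, ← Cardinal.mk_le_aleph0_iff, hWc] at hcnt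
      exact absurd hcnt (not_le.2 Cardinal.aleph0_lt_aleph_one)
    obtain ⟨w, hw⟩ := (Set.ne_univ_iff_exists_notMem _).1 hne
    refine ⟨w, fun p hp q hq => ?_⟩
    by_contra hlt
    exact hw (Set.mem_biUnion (Set.mem_image_of_mem d (Set.mk_mem_prod hp hq)) (not_lt.1 hlt))
  obtain ⟨x, hx, y, hy, hag, hne⟩ := hF (s '' Set.Iio w) ((hIio w).image s) _ hH
  rw [← hs w] at hne
  have hne' : (fun w => c (s w) x) ≠ (fun w => c (s w) y) := fun h => hne (congrFun h w)
  exact hd (_, _) hne' (hag _ ⟨_, hw _ hx _ hy, rfl⟩)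

open Filter in
theorem factor_lemma {K : Type} {κ : Cardinal.{0}} (U : Ultrafilter K)
    (hκ : 2 ^ Cardinal.aleph 1 < κ)
    (hind : ∀ μ : Cardinal.{0}, Cardinal.aleph 1 ≤ μ → μ < κ → ¬ MuDecomposable U μ)
    (L : K → Type) (hL : ∀ a, #(L a) < κ) (g : ∀ a, K → L a) :
    ∃ (h : K → ℕ) (p : ∀ a, ℕ → L a), ∀ a, ∀ᶠ x in (U : Filter K), g a x = p a (h x) := by
  classical
  choose c q hcq using fun a => countable_code U hind (hL a) (g a)
  obtain ⟨S, hS, hdet⟩ := silver_lemma U hκ hind c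
  have hcard : #(S → ℕ) < κ := by
    rw [← Cardinal.power_def, Cardinal.mk_nat]
    refine lt_of_le_of_lt ?_ hκ
    rw [← Cardinal.power_self_eq (Cardinal.aleph0_le_aleph 1)]
    refine (Cardinal.power_le_power_right (Cardinal.aleph0_le_aleph 1)).trans ?_
    refine Cardinal.power_le_power_left (Cardinal.aleph_pos 1).ne' ?_
    exact (Cardinal.le_aleph0_iff_set_countable.2 hS).trans (Cardinal.aleph0_le_aleph 1)
  obtain ⟨h, r, hr⟩ := countable_code U hind hcard (fun x (s : S) => c s x)
  have key : ∀ a, ∃ p : ℕ → L a, ∀ᶠ x in (U : Filter K), g a x = p (h x) := by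
    intro a
    obtain ⟨X, hX, hXd⟩ := hdet a
    obtain ⟨x0, -⟩ := U.nonempty_of_mem hX
    let Y : Set K := {x | x ∈ X ∧ g a x = q a (c a x) ∧ (fun (s : S) => c s x) = r (h x)}
    have hY : Y ∈ (U : Filter K) := by
      filter_upwards [hX, hcq a, hr] with x h1 h2 h3
      exact ⟨h1, h2, h3⟩
    refine ⟨fun n => if hn : ∃ x ∈ Y, h x = n then g a hn.choose else g a x0, ?_⟩
    filter_upwards [hY] with x hx
    have hn : ∃ y ∈ Y, h y = h x := ⟨x, hx, rfl⟩
    simp only [dif_pos hn]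
    obtain ⟨hy, hyx⟩ := hn.choose_spec
    rw [hx.2.1, hy.2.1]
    congr 1
    refine hXd _ hx.1 _ hy.1 (fun s hs => ?_)
    have := hx.2.2.trans ((congrArg r hyx).symm.trans hy.2.2.symm)
    exact congrFun this ⟨s, hs⟩
  choose p hp using key
  exact ⟨h, p, hp⟩

/-- If a regular cardinal `κ > 2^ℵ₁` carries a uniform indecomposable ultrafilter,
then every `κ`-Aronszajn tree admits an `ω`-ascent path. -/
theorem stmt13 {K : Type} (κ : Cardinal.{0}) (hκreg : κ.IsRegular)
    (hκ : 2 ^ Cardinal.aleph 1 < κ) (hK : #K = κ)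
    (U : Ultrafilter K) (hU : UniformUF U)
    (hind : ∀ μ : Cardinal.{0}, Cardinal.aleph 1 ≤ μ → μ < κ → ¬ MuDecomposable U μ)
    (T : OrdTree) (hT : T.Aronszajn κ) :
    ∃ f : Ordinal.{0} → ℕ → T.carrier,
      (∀ α < κ.ord, ∀ i, T.level (f α i) = α) ∧
      ∀ α β, α < β → β < κ.ord → {i : ℕ | ¬ T.lt (f α i) (f β i)}.Finite := by
  classical
  obtain ⟨⟨htrans, hirr, hlev, hpred, hcomp, hlt, hex⟩, hsmall, -⟩ := hT
  have hinf : ℵ₀ ≤ κ := hκreg.aleph0_le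
  -- enumerate `K` by ordinals below `κ`
  obtain ⟨e⟩ : Nonempty (K ≃ κ.ord.ToType) := Cardinal.eq.1 (by simp [hK])
  let o : K → Ordinal.{0} := fun x => (Ordinal.ToType.mk.symm (e x) : Set.Iio κ.ord)
  have ho : ∀ x, o x < κ.ord := fun x => (Ordinal.ToType.mk.symm (e x) : Set.Iio κ.ord).2
  have hsmallset : ∀ α < κ.ord, #{x | o x < α} < κ := by
    intro α hα
    refine lt_of_le_of_lt ?_ (Cardinal.mk_Iio_toType_ord_lt (Ordinal.ToType.mk ⟨α, hα⟩))
    refine Cardinal.mk_le_of_injective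
      (f := fun x : {x | o x < α} => (⟨e x.1, ?_⟩ : Set.Iio (Ordinal.ToType.mk ⟨α, hα⟩))) ?_
    · rw [Set.mem_Iio, ← OrderIso.symm_apply_lt]
      exact x.2
    · intro x y hxy
      have := congrArg Subtype.val hxy
      exact Subtype.ext (e.injective this)
  have hlarge : ∀ α < κ.ord, ∀ᶠ x in (U : Filter K), α < o x := by
    intro α hα
    have hs : Order.succ α < κ.ord := (Cardinal.isSuccLimit_ord hinf).succ_lt hα
    by_contra hn
    have hm : {x | α < o x}ᶜ ∈ U := Ultrafilter.compl_mem_iff_notMem.2 hn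
    have h1 := hU _ hm
    have h2 := hsmallset _ hs
    have h3 : {x | α < o x}ᶜ = {x | o x < Order.succ α} := by
      ext x; simp [Order.lt_succ_iff]
    rw [h3, hK] at h1
    exact h2.ne h1
  -- restriction of nodes
  have hres : ∀ (y : T.carrier) (α : Ordinal.{0}), α < κ.ord →
      ∃ x, T.level x = α ∧ (α < T.level y → T.lt x y) ∧ (α = T.level y → x = y) := by
    intro y α hα
    rcases lt_trichotomy α (T.level y) with h | h | h
    · obtain ⟨x, ⟨h1, h2⟩, -⟩ := hpred y α h
      exact ⟨x, h2, fun _ => h1, fun h' => (h.ne h').elim⟩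
    · exact ⟨y, h.symm, fun h' => (h'.ne h).elim, fun _ => rfl⟩
    · obtain ⟨x, hx⟩ := hex α hα
      exact ⟨x, hx, fun h' => (lt_asymm h h').elim, fun h' => (h.ne' h').elim⟩
  have hcmp : ∀ x y z, T.lt x z → T.lt y z → T.level x < T.level y → T.lt x y := by
    intro x y z hx hy hl
    rcases hcomp x y z hx hy with h | h | h
    · subst h; exact (lt_irrefl _ hl).elim
    · exact h
    · exact (lt_asymm hl (hlev _ _ h)).elim
  choose t ht using fun x : K => hex (o x) (ho x)
  choose res hres1 hres2 hres3 using hres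
  let L : K → Type := fun a => {x : T.carrier // T.level x = o a}
  let g : ∀ a, K → L a := fun a x => ⟨res (t x) (o a) (ho a), hres1 _ _ _⟩
  obtain ⟨h, p, hp⟩ := factor_lemma U hκ hind L (fun a => hsmall _ (ho a)) g
  let A : K → K → Set ℕ := fun a b => {n | T.lt (p a n).1 (p b n).1}
  let V : Ultrafilter ℕ := U.map h
  have hA : ∀ a b, o a < o b → A a b ∈ V := by
    intro a b hab
    change h ⁻¹' (A a b) ∈ U
    filter_upwards [hp a, hp b, hlarge _ (ho b)] with x h1 h2 h3
    change T.lt (p a (h x)).1 (p b (h x)).1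
    rw [← h1, ← h2]
    refine hcmp _ _ (t x) (hres2 _ _ _ ?_) (hres2 _ _ _ ?_) ?_
    · rw [ht]; exact hab.trans h3
    · rw [ht]; exact h3
    · rw [hres1, hres1]; exact hab
  have hc0 : (2 : Cardinal.{0}) ^ ℵ₀ < κ :=
    (Cardinal.power_le_power_left two_ne_zero (Cardinal.aleph0_le_aleph 1)).trans_lt hκ
  have hcS : #(Set ℕ) < κ := by
    rw [Cardinal.mk_set, Cardinal.mk_nat]; exact hc0
  have hcB : #(ℕ → Set ℕ) < κ := by
    rw [← Cardinal.power_def, Cardinal.mk_set, Cardinal.mk_nat, ← Cardinal.power_mul,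
      Cardinal.aleph0_mul_aleph0]
    exact hc0
  have hB : ∀ a, ∃ B : ℕ → Set ℕ, (∀ m, B m ∈ V) ∧
      ∀ᶠ b in (U : Filter K), ∃ m, B m = A a b := by
    intro a
    obtain ⟨c, B, hB⟩ := countable_code U hind hcS (A a)
    refine ⟨fun m => if B m ∈ V then B m else Set.univ, fun m => ?_, ?_⟩
    · dsimp only
      split_ifs with hm
      · exact hm
      · exact Filter.univ_mem
    · filter_upwards [hB, hlarge _ (ho a)] with b h1 h2
      refine ⟨c b, ?_⟩
      rw [if_pos (h1 ▸ hA a b h2), h1]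
  choose B hBV hBA using hB
  obtain ⟨B0, hB0⟩ := Cardinal.infinite_pigeonhole B (hK ▸ hinf)
    (by rw [hK, hκreg.cof_ord]; exact hcB)
  have hunb : ∀ α < κ.ord, ∃ a, B a = B0 ∧ α ≤ o a := by
    intro α hα
    by_contra! hn
    have : B ⁻¹' {B0} ⊆ {x | o x < α} := fun x hx => hn x hx
    have := (Cardinal.mk_le_mk_of_subset this).trans_lt (hsmallset α hα)
    rw [hB0, hK] at this
    exact this.false
  have hBV0 : ∀ m, B0 m ∈ V := by
    obtain ⟨a, ha, -⟩ := hunb 0 (lt_of_le_of_lt zero_le (ho (U.nonempty_of_mem (Filter.univ_mem : Set.univ ∈ (U : Filter K))).some))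
    exact ha ▸ hBV a
  have hk : ∀ n : ℕ, ∃ k, ∀ m ≤ n, k ∈ B0 m := by
    intro n
    have : (⋂ m ∈ Set.Iic n, B0 m) ∈ (V : Filter ℕ) :=
      (Filter.biInter_mem (Set.finite_Iic n)).2 (fun m _ => hBV0 m)
    obtain ⟨k, hk⟩ := V.nonempty_of_mem this
    exact ⟨k, fun m hm => Set.mem_iInter₂.1 hk m hm⟩
  choose k hk using hk
  have hgood : ∀ a, B a = B0 → ∀ᶠ b in (U : Filter K),
      ∃ m, ∀ n ≥ m, T.lt (p a (k n)).1 (p b (k n)).1 := by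
    intro a ha
    filter_upwards [hBA a] with b hb
    obtain ⟨m, hm⟩ := hb
    refine ⟨m, fun n hn => ?_⟩
    have := hk n m hn
    rw [← ha, hm] at this
    exact this
  have hGam : ∀ a b, B a = B0 → B b = B0 → o a < o b →
      ∃ m, ∀ n ≥ m, T.lt (p a (k n)).1 (p b (k n)).1 := by
    intro a b ha hb hab
    obtain ⟨z, ⟨m1, hz1⟩, ⟨m2, hz2⟩⟩ := ((hgood a ha).and (hgood b hb)).exists
    refine ⟨max m1 m2, fun n hn => ?_⟩
    refine hcmp _ _ _ (hz1 n (le_of_max_le_left hn)) (hz2 n (le_of_max_le_right hn)) ?_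
    rw [(p a _).2, (p b _).2]; exact hab
  -- least element of the homogeneous set above `α`
  have hleast : ∀ α < κ.ord, ∃ a, B a = B0 ∧ α ≤ o a ∧ ∀ b, B b = B0 → α ≤ o b → o a ≤ o b := by
    intro α hα
    let S : Set K := {a | B a = B0 ∧ α ≤ o a}
    have hS : S.Nonempty := hunb α hα
    have wf : WellFounded (fun x y : K => o x < o y) := InvImage.wf o wellFounded_lt
    obtain ⟨a, ha, hmin⟩ := wf.has_min S hS
    exact ⟨a, ha.1, ha.2, fun b h1 h2 => not_lt.1 (hmin b ⟨h1, h2⟩)⟩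
  have hoinj : ∀ a b, o a = o b → a = b := by
    intro a b hab
    exact e.injective (Ordinal.ToType.mk.symm.injective (Subtype.ext hab))
  choose γ hγ1 hγ2 hγ3 using hleast
  let f : Ordinal.{0} → ℕ → T.carrier := fun α i =>
    if hα : α < κ.ord then res (p (γ α hα) (k i)).1 α hα else t (γ 0 (by
      rw [Cardinal.lt_ord]; simpa using (Cardinal.aleph0_pos.trans_le hinf)))
  refine ⟨f, fun α hα i => ?_, fun α β hαβ hβ => ?_⟩
  · simp only [f, dif_pos hα]; exact hres1 _ _ _
  · have hα : α < κ.ord := hαβ.trans hβ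
    have hfl : ∀ δ (hδ : δ < κ.ord) i, f δ i = (p (γ δ hδ) (k i)).1 ∨
        T.lt (f δ i) (p (γ δ hδ) (k i)).1 := by
      intro δ hδ i
      simp only [f, dif_pos hδ]
      rcases (hγ2 δ hδ).eq_or_lt with h' | h'
      · exact Or.inl (hres3 _ _ _ (by rw [(p _ _).2]; exact h'))
      · exact Or.inr (hres2 _ _ _ (by rw [(p _ _).2]; exact h'))
    have hfle : ∀ δ (hδ : δ < κ.ord) i, T.level (f δ i) = δ := by
      intro δ hδ i
      simp only [f, dif_pos hδ]; exact hres1 _ _ _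
    have hle : o (γ α hα) ≤ o (γ β hβ) := hγ3 α hα _ (hγ1 β hβ) (hαβ.le.trans (hγ2 β hβ))
    obtain ⟨m, hm⟩ : ∃ m, ∀ n ≥ m, (p (γ α hα) (k n)).1 = (p (γ β hβ) (k n)).1 ∨
        T.lt (p (γ α hα) (k n)).1 (p (γ β hβ) (k n)).1 := by
      rcases hle.eq_or_lt with h' | h'
      · have := hoinj _ _ h'
        exact ⟨0, fun n _ => Or.inl (by rw [this])⟩
      · obtain ⟨m, hm⟩ := hGam _ _ (hγ1 α hα) (hγ1 β hβ) h'
        exact ⟨m, fun n hn => Or.inr (hm n hn)⟩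
    refine (Set.finite_Iio m).subset (fun i hi => ?_)
    by_contra hmi
    apply hi
    have hlev' : T.level (f α i) < T.level (f β i) := by rw [hfle α hα, hfle β hβ]; exact hαβ
    have h1 : f α i = (p (γ β hβ) (k i)).1 ∨ T.lt (f α i) (p (γ β hβ) (k i)).1 := by
      rcases hm i (not_lt.1 hmi) with h' | h'
      · rw [← h']; exact hfl α hα i
      · rcases hfl α hα i with h'' | h''
        · exact Or.inr (h''.symm ▸ h')
        · exact Or.inr (htrans _ _ _ h'' h')
    rcases hfl β hβ i with h2 | h2
    · rcases h1 with h1 | h1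
      · rw [h1, h2] at hlev'; exact (lt_irrefl _ hlev').elim
      · rw [h2]; exact h1
    · rcases h1 with h1 | h1
      · rw [← h1] at h2; exact (lt_asymm hlev' (hlev _ _ h2)).elim
      · exact hcmp _ _ _ h1 h2 hlev'
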